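/- arXiv:1412.3705 — 8 statements merged into one kernel-verified Lean document; each statement's English description precedes it below -/
import Mathlib

section
/- Suppose 0 < ε ≤ 1, 0 < η ≤ min(p_i, p_j) ≤ 1, and the random variables F, G, H satisfy 0 ≤ F ≤ G, 0 ≤ F ≤ H almost surely together with the tail bounds P(|F − p_{i,j}| ≥ t) ≤ 2·exp(−t²MN), P(|G − p_i| ≥ t) ≤ 2·exp(−2t²MN), and P(|H − p_j| ≥ t) ≤ 2·exp(−2t²MN) for all t > 0. Then P( |F/(G·H) − p_{i,j}/(p_i·p_j)| ≥ ε ) ≤ 8·exp(−ε²·η⁴·M·N/20). -/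
open MeasureTheory ProbabilityTheory

lemma ratio_aux (r c x t : ℝ) (h0 : 0 ≤ r) (h1 : r ≤ c) (ht : 0 ≤ t) (hx : x ≤ t) :
    r * x ≤ c * t :=
  (mul_le_mul_of_nonneg_left hx h0).trans (mul_le_mul_of_nonneg_right h1 ht)

lemma ratio_det (F G H a p q ε η t : ℝ) (hF : 0 ≤ F) (hp1 : p ≤ 1)
    (hε : 0 < ε) (hε1 : ε ≤ 1) (hη : 0 < η) (hηp : η ≤ p) (hηq : η ≤ q)
    (hFG : F ≤ G) (hFH : F ≤ H) (ht : t = ε * η ^ 2 / 4)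
    (h1 : |F - a| < t) (h2 : |G - p| < t) (h3 : |H - q| < t) :
    |F / (G * H) - a / (p * q)| < ε := by
  have htpos : 0 < t := by rw [ht]; positivity
  have htη : t ≤ η / 4 := by
    have : ε * η ^ 2 ≤ 1 * (η * 1) := by
      have : η ^ 2 ≤ η * 1 := by nlinarith
      exact mul_le_mul hε1 this (by positivity) (by norm_num)
    linarith
  rw [abs_lt] at h1 h2 h3
  have hp : 0 < p := by linarith
  have hq : 0 < q := by linarith
  have hG : 0 < G := by linarith
  have hH : 0 < H := by linarith
  obtain ⟨R, hR⟩ : ∃ R, R = F / (G * H) := ⟨_, rfl⟩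
  have hR0 : 0 ≤ R := by rw [hR]; positivity
  have hRF : R * G * H = F := by rw [hR]; field_simp
  have hRG : R * G ≤ 1 := by
    have : (R * G) * H ≤ 1 * H := by linarith
    exact le_of_mul_le_mul_right this hH
  have hRH : R * H ≤ 1 := by
    have : (R * H) * G ≤ 1 * G := by linarith
    exact le_of_mul_le_mul_right this hG
  have hRp : R * p ≤ 4 / 3 := by
    have : R * (3 / 4 * p) ≤ R * G := mul_le_mul_of_nonneg_left (by linarith) hR0
    linarith
  have hRp0 : 0 ≤ R * p := by positivity
  have hRH0 : 0 ≤ R * H := by positivity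
  have hpq : η ^ 2 ≤ p * q := by
    rw [pow_two]; exact mul_le_mul hηp hηq hη.le hp.le
  have hεpq : 4 * t ≤ ε * (p * q) := by
    have := mul_le_mul_of_nonneg_left hpq hε.le
    linarith
  have e : R - a / (p * q) = ((F - a) + (R * p) * (q - H) + (R * H) * (p - G)) / (p * q) := by
    field_simp
    linarith
  rw [← hR, e, abs_div, abs_of_pos (mul_pos hp hq), div_lt_iff₀ (mul_pos hp hq), abs_lt]
  have b1 := ratio_aux (R * p) (4 / 3) (q - H) t hRp0 hRp htpos.le (by linarith)
  have b2 := ratio_aux (R * p) (4 / 3) (-(q - H)) t hRp0 hRp htpos.le (by linarith)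
  have b3 := ratio_aux (R * H) 1 (p - G) t hRH0 hRH htpos.le (by linarith)
  have b4 := ratio_aux (R * H) 1 (-(p - G)) t hRH0 hRH htpos.le (by linarith)
  rw [mul_neg] at b2 b4
  constructor <;> linarith

/-- Entrywise concentration of the normalized second-moment estimate.
If `0 < ε ≤ 1`, `0 < η ≤ min(p_i, p_j) ≤ 1`, `0 ≤ F ≤ G` and `0 ≤ F ≤ H` a.s., and
`F, G, H` satisfy the stated sub-Gaussian tail bounds around `p_{i,j}, p_i, p_j`, then
`P(|F/(G·H) − p_{i,j}/(p_i·p_j)| ≥ ε) ≤ 8·exp(−ε²·η⁴·M·N/20)`. -/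
theorem ratio_concentration
    (Ω : Type*) [MeasureSpace Ω] [IsProbabilityMeasure (ℙ : Measure Ω)]
    (M N : ℕ) (hM : 0 < M) (hN : 0 < N)
    (F G H : Ω → ℝ)
    (hFmeas : Measurable F) (hGmeas : Measurable G) (hHmeas : Measurable H)
    (hFr : ∀ ω, F ω ∈ Set.Icc (0 : ℝ) 1)
    (hGr : ∀ ω, G ω ∈ Set.Icc (0 : ℝ) 1)
    (hHr : ∀ ω, H ω ∈ Set.Icc (0 : ℝ) 1)
    (pij pi pj : ℝ)
    (hpij : pij ∈ Set.Ioc (0 : ℝ) 1) (hpi : pi ∈ Set.Ioc (0 : ℝ) 1)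
    (hpj : pj ∈ Set.Ioc (0 : ℝ) 1)
    (hpij_le_i : pij ≤ pi) (hpij_le_j : pij ≤ pj)
    (ε η : ℝ) (hε : 0 < ε) (hε1 : ε ≤ 1)
    (hη : 0 < η) (hηle : η ≤ min pi pj) (hmin1 : min pi pj ≤ 1)
    (hFG : ∀ᵐ ω ∂ℙ, F ω ≤ G ω) (hFH : ∀ᵐ ω ∂ℙ, F ω ≤ H ω)
    (hFtail : ∀ t : ℝ, 0 < t →
      ℙ {ω | t ≤ |F ω - pij|} ≤ ENNReal.ofReal (2 * Real.exp (-(t ^ 2 * M * N))))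
    (hGtail : ∀ t : ℝ, 0 < t →
      ℙ {ω | t ≤ |G ω - pi|} ≤ ENNReal.ofReal (2 * Real.exp (-(2 * t ^ 2 * M * N))))
    (hHtail : ∀ t : ℝ, 0 < t →
      ℙ {ω | t ≤ |H ω - pj|} ≤ ENNReal.ofReal (2 * Real.exp (-(2 * t ^ 2 * M * N)))) :
    ℙ {ω | ε ≤ |F ω / (G ω * H ω) - pij / (pi * pj)|} ≤
      ENNReal.ofReal (8 * Real.exp (-(ε ^ 2 * η ^ 4 * M * N / 20))) := by
  obtain ⟨t, ht⟩ : ∃ t, t = ε * η ^ 2 / 4 := ⟨_, rfl⟩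
  have htpos : 0 < t := by rw [ht]; positivity
  have hsub : ℙ {ω | ε ≤ |F ω / (G ω * H ω) - pij / (pi * pj)|} ≤
      ℙ ({ω | t ≤ |F ω - pij|} ∪ {ω | t ≤ |G ω - pi|} ∪ {ω | t ≤ |H ω - pj|}) := by
    apply measure_mono_ae
    filter_upwards [hFG, hFH] with ω h1 h2 h3
    by_contra hc
    have hc' : ¬ ((t ≤ |F ω - pij| ∨ t ≤ |G ω - pi|) ∨ t ≤ |H ω - pj|) := hc
    push Not at hc'
    have h3' : ε ≤ |F ω / (G ω * H ω) - pij / (pi * pj)| := h3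
    exact absurd h3' (not_le.mpr (ratio_det _ _ _ _ _ _ ε η t (hFr ω).1 hpi.2 hε hε1 hη
      (hηle.trans (min_le_left _ _)) (hηle.trans (min_le_right _ _)) h1 h2 ht
      hc'.1.1 hc'.1.2 hc'.2))
  have hMN : (0 : ℝ) ≤ ε ^ 2 * η ^ 4 * M * N := by positivity
  have e1 : t ^ 2 * M * N = ε ^ 2 * η ^ 4 * M * N / 16 := by rw [ht]; ring
  have e2 : 2 * t ^ 2 * M * N = ε ^ 2 * η ^ 4 * M * N / 8 := by rw [ht]; ring
  have x1 : Real.exp (-(t ^ 2 * M * N)) ≤ Real.exp (-(ε ^ 2 * η ^ 4 * M * N / 20)) :=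
    Real.exp_le_exp.mpr (by rw [e1]; linarith)
  have x2 : Real.exp (-(2 * t ^ 2 * M * N)) ≤ Real.exp (-(ε ^ 2 * η ^ 4 * M * N / 20)) :=
    Real.exp_le_exp.mpr (by rw [e2]; linarith)
  have x0 := Real.exp_pos (-(ε ^ 2 * η ^ 4 * M * N / 20))
  refine hsub.trans ((measure_union_le _ _).trans ((add_le_add ((measure_union_le _ _).trans
    (add_le_add (hFtail t htpos) (hGtail t htpos))) (hHtail t htpos)).trans ?_))
  rw [← ENNReal.ofReal_add (by positivity) (by positivity),
    ← ENNReal.ofReal_add (by positivity) (by positivity)]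
  exact ENNReal.ofReal_le_ofReal (by linarith)
end

section
/- Assume B̄ is separable, R̄ is symmetric positive definite, and b < 1. Then: (1) if rows i and j are both novel rows for the same ranking k, then E_i = E_j (and consequently E_{i,i} − 2E_{i,j} + E_{j,j} = 0); (2) if i ∈ C_k is a novel row for ranking k and j ∉ C_k, then ‖E_i − E_j‖₂ ≥ (1−b)·λ_min and E_{i,i} − 2E_{i,j} + E_{j,j} ≥ (1−b)²·λ_min²/λ_max. -/
open Matrix

/-- Row `i` of `B` is a novel row for ranking `k`: the `i`-th row of `B` equals the
`k`-th standard basis vector. -/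
def IsNovelRow {W K : ℕ} (B : Matrix (Fin W) (Fin K) ℝ) (i : Fin W) (k : Fin K) : Prop :=
  ∀ l, B i l = if l = k then 1 else 0

/-- Separation of novel rows of `E = B̄·R̄·B̄ᵀ`.
(1) Two novel rows for the same ranking `k` have identical rows of `E` (so
`E_{i,i} − 2E_{i,j} + E_{j,j} = 0`); (2) if `i` is novel for `k` and `j` is not, then
`‖E_i − E_j‖₂ ≥ (1−b)·λ_min` and `E_{i,i} − 2E_{i,j} + E_{j,j} ≥ (1−b)²·λ_min²/λ_max`. -/
theorem novel_row_separation
    (W K : ℕ) (hKW : K ≤ W)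
    (B : Matrix (Fin W) (Fin K) ℝ)
    (hBnn : ∀ i k, 0 ≤ B i k) (hBrow : ∀ i, ∑ k, B i k = 1)
    (hsep : ∀ k, ∃ i, IsNovelRow B i k)
    (R : Matrix (Fin K) (Fin K) ℝ) (hRsymm : R.IsSymm) (hR : R.PosDef)
    (lammin lammax : ℝ) (hlammin : 0 < lammin)
    (hmin : ∀ x : Fin K → ℝ, lammin * ∑ k, x k ^ 2 ≤ x ⬝ᵥ R.mulVec x)
    (hmax : ∀ x : Fin K → ℝ, x ⬝ᵥ R.mulVec x ≤ lammax * ∑ k, x k ^ 2)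
    (b : ℝ) (hb0 : 0 ≤ b) (hb1 : b < 1)
    (hbmax : ∀ j k, (∀ k', ¬ IsNovelRow B j k') → B j k ≤ b)
    (E : Matrix (Fin W) (Fin W) ℝ) (hE : E = B * R * Bᵀ) :
    (∀ i j : Fin W, ∀ k : Fin K, IsNovelRow B i k → IsNovelRow B j k →
        (∀ l, E i l = E j l) ∧ E i i - 2 * E i j + E j j = 0) ∧
    (∀ i j : Fin W, ∀ k : Fin K, IsNovelRow B i k → ¬ IsNovelRow B j k →
        (1 - b) * lammin ≤ Real.sqrt (∑ l, (E i l - E j l) ^ 2) ∧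
        (1 - b) ^ 2 * lammin ^ 2 / lammax ≤ E i i - 2 * E i j + E j j) := by
  have hEe : ∀ i l, E i l = B i ⬝ᵥ R *ᵥ (B l) := by
    intro i l
    rw [hE, Matrix.mul_assoc]; rfl
  have hsw : ∀ u v : Fin K → ℝ, u ⬝ᵥ R *ᵥ v = v ⬝ᵥ R *ᵥ u := by
    intro u v
    rw [Matrix.dotProduct_mulVec, dotProduct_comm, ← Matrix.mulVec_transpose, hRsymm.eq]
  constructor
  · intro i j k hi hj
    have hB : B i = B j := funext fun l => by rw [hi l, hj l]
    refine ⟨fun l => by rw [hEe, hEe, hB], ?_⟩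
    simp only [hEe, hB]
    ring
  · intro i j k hi hj
    obtain ⟨x, hx⟩ : ∃ x, x = B i - B j := ⟨_, rfl⟩
    have hBk : B j k ≤ b := by
      by_cases h : ∃ k', IsNovelRow B j k'
      · obtain ⟨k', h'⟩ := h
        have hne : k ≠ k' := by
          rintro rfl
          exact hj h'
        rw [h' k, if_neg hne]
        exact hb0
      · push Not at h
        exact hbmax j k h
    have hxk : 1 - b ≤ x k := by
      have h1 := hi k
      simp only [if_true] at h1
      rw [hx, Pi.sub_apply, h1]
      linarith
    have hS : (1 - b) ^ 2 ≤ ∑ k, x k ^ 2 :=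
      le_trans (by nlinarith) (Finset.single_le_sum (f := fun k => x k ^ 2)
        (fun _ _ => sq_nonneg _) (Finset.mem_univ k))
    have hSpos : 0 < ∑ k, x k ^ 2 := lt_of_lt_of_le (by nlinarith) hS
    have h1 := hmin x
    have h2 := hmax x
    have hq : E i i - 2 * E i j + E j j = x ⬝ᵥ R *ᵥ x := by
      rw [hx, Matrix.mulVec_sub, dotProduct_sub, sub_dotProduct, sub_dotProduct,
        hEe, hEe, hEe, hsw (B j) (B i)]
      ring
    constructor
    · apply Real.le_sqrt_of_sq_le
      have hcs : (x ⬝ᵥ R *ᵥ x) ^ 2 ≤ (∑ k, x k ^ 2) * ∑ k, (R *ᵥ x) k ^ 2 :=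
        Finset.sum_mul_sq_le_sq_mul_sq Finset.univ x (R *ᵥ x)
      choose f hf using hsep
      have hfi : Function.Injective f := by
        intro a c hac
        by_contra hne
        have h3 := hf a a
        rw [hac, hf c a, if_neg hne, if_pos rfl] at h3
        exact zero_ne_one h3
      have hfe : ∀ m, E i (f m) - E j (f m) = (R *ᵥ x) m := by
        intro m
        have hB : B (f m) = Pi.single m 1 := by
          funext l
          rw [hf m l, Pi.single_apply]
        rw [hEe, hEe, ← sub_dotProduct, ← hx, hsw, hB, single_dotProduct, one_mul]
      have hle : ∑ k, (R *ᵥ x) k ^ 2 ≤ ∑ l, (E i l - E j l) ^ 2 := by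
        calc ∑ k, (R *ᵥ x) k ^ 2 = ∑ k, (E i (f k) - E j (f k)) ^ 2 := by simp only [hfe]
          _ = ∑ l ∈ Finset.univ.map ⟨f, hfi⟩, (E i l - E j l) ^ 2 := by
            rw [Finset.sum_map]; rfl
          _ ≤ _ := Finset.sum_le_sum_of_subset_of_nonneg (Finset.subset_univ _)
            (fun _ _ _ => sq_nonneg _)
      refine le_trans ?_ hle
      generalize (∑ k, x k ^ 2) = S at *
      generalize (∑ k, (R *ᵥ x) k ^ 2) = T at *
      have h4 : (lammin * S) ^ 2 ≤ S * T :=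
        le_trans (pow_le_pow_left₀ (by positivity) h1 2) hcs
      have h5 : lammin ^ 2 * S ≤ T := by
        refine le_of_mul_le_mul_left ?_ hSpos
        linarith [h4, mul_pow lammin S 2, (by ring : S * (lammin ^ 2 * S) = (lammin * S) ^ 2)]
      have h6 := mul_le_mul_of_nonneg_left hS (sq_nonneg lammin)
      rw [mul_pow]
      linarith
    · rw [hq]
      have hll : lammin ≤ lammax := le_of_mul_le_mul_right (h1.trans h2) hSpos
      have hl : 0 < lammax := by linarith
      have h6 := mul_le_mul_of_nonneg_left hS hlammin.le
      refine le_trans ?_ (h6.trans h1)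
      rw [div_le_iff₀ hl]
      have h7 := mul_le_mul_of_nonneg_left hll (mul_nonneg hlammin.le (sq_nonneg (1 - b)))
      linarith
end

section
/- Let R be a K×K real symmetric positive-definite matrix whose smallest eigenvalue is λ > 0. Then for every index i and every collection of nonnegative weights (c_j)_{j≠i} with Σ_{j≠i} c_j = 1, the Euclidean distance ‖R_i − Σ_{j≠i} c_j R_j‖₂ ≥ λ, where R_i denotes the i-th row of R. In other words, every row of R is at Euclidean distance at least λ from the convex hull of the remaining rows. -/
open Matrix

/-- A symmetric positive-definite matrix `R` whose smallest eigenvalue is `λ`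
is `λ`-simplicial: every row of `R` is at Euclidean distance at least `λ` from every convex
combination of the remaining rows. -/
theorem posdef_simplicial
    (K : ℕ) (R : Matrix (Fin K) (Fin K) ℝ) (hRsymm : R.IsSymm) (hR : R.PosDef)
    (lam : ℝ) (hlam : 0 < lam)
    (hmin : ∀ x : Fin K → ℝ, lam * ∑ k, x k ^ 2 ≤ x ⬝ᵥ R.mulVec x)
    (i : Fin K) (c : Fin K → ℝ)
    (hc0 : ∀ j, j ≠ i → 0 ≤ c j)
    (hcsum : ∑ j ∈ Finset.univ.erase i, c j = 1) :
    lam ≤ Real.sqrt (∑ l, (R i l - ∑ j ∈ Finset.univ.erase i, c j * R j l) ^ 2) := by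
  set x : Fin K → ℝ := fun k => if k = i then 1 else -c k with hx
  have hy : ∀ l, R i l - ∑ j ∈ Finset.univ.erase i, c j * R j l = R.mulVec x l := by
    intro l
    have h1 : R.mulVec x l = ∑ k, R l k * x k := rfl
    rw [h1, ← Finset.add_sum_erase _ _ (Finset.mem_univ i), sub_eq_add_neg,
      ← Finset.sum_neg_distrib]
    congr 1
    · simp [hx, hRsymm.apply i l]
    · refine Finset.sum_congr rfl fun j hj => ?_
      have hji : j ≠ i := Finset.ne_of_mem_erase hj
      simp only [hx, if_neg hji, hRsymm.apply j l]
      rw [← hRsymm.apply j l]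
      ring
  simp only [hy]
  have hS : 1 ≤ ∑ k, x k ^ 2 := by
    have h := Finset.single_le_sum (f := fun k => x k ^ 2) (fun k _ => sq_nonneg (x k))
      (Finset.mem_univ i)
    simpa [hx] using h
  have hm := hmin x
  have hcs : (x ⬝ᵥ R.mulVec x) ^ 2 ≤ (∑ k, x k ^ 2) * ∑ k, R.mulVec x k ^ 2 :=
    Finset.sum_mul_sq_le_sq_mul_sq Finset.univ x (R.mulVec x)
  generalize (∑ k, x k ^ 2) = S at *
  generalize (∑ k, R.mulVec x k ^ 2) = Y at *
  apply Real.le_sqrt_of_sq_le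
  have hSp : 0 < S := by linarith
  have h2 : (lam * S) ^ 2 ≤ S * Y := (pow_le_pow_left₀ (by positivity) hm 2).trans hcs
  have h3 : lam ^ 2 * S ≤ Y := by
    refine le_of_mul_le_mul_left ?_ hSp
    linarith [h2, show (lam * S) ^ 2 = S * (lam ^ 2 * S) by ring]
  nlinarith [sq_nonneg lam]
end

section
/- Assume B̄ is separable, R̄ is symmetric positive definite, and b < 1; set d = (1−b)²·λ_min²/λ_max. Let Ê be any W×W real matrix with max_{i,j} |Ê_{i,j} − E_{i,j}| < d/8, and for each row i define J_i = { j : Ê_{i,i} − Ê_{i,j} − Ê_{j,i} + Ê_{j,j} ≥ d/2 }. Then for every novel row i ∈ C_k, J_i equals exactly the complement of C_k, i.e., J_i = { j : j ∉ C_k }. -/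
open Matrix

/-- If `max_{u,v} |Ê_{u,v} − E_{u,v}| < d/8` where
`d = (1−b)²·λ_min²/λ_max`, then for every novel row `i ∈ C_k`, the set
`J_i = { j : Ê_{i,i} − Ê_{i,j} − Ê_{j,i} + Ê_{j,j} ≥ d/2 }` is exactly the complement
of `C_k`. -/
theorem novel_row_neighborhood_identification
    (W K : ℕ) (hKW : K ≤ W)
    (B : Matrix (Fin W) (Fin K) ℝ)
    (hBnn : ∀ i k, 0 ≤ B i k) (hBrow : ∀ i, ∑ k, B i k = 1)
    (hsep : ∀ k, ∃ i, IsNovelRow B i k)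
    (R : Matrix (Fin K) (Fin K) ℝ) (hRsymm : R.IsSymm) (hR : R.PosDef)
    (lammin lammax : ℝ) (hlammin : 0 < lammin)
    (hmin : ∀ x : Fin K → ℝ, lammin * ∑ k, x k ^ 2 ≤ x ⬝ᵥ R.mulVec x)
    (hmax : ∀ x : Fin K → ℝ, x ⬝ᵥ R.mulVec x ≤ lammax * ∑ k, x k ^ 2)
    (b : ℝ) (hb0 : 0 ≤ b) (hb1 : b < 1)
    (hbmax : ∀ j k, (∀ k', ¬ IsNovelRow B j k') → B j k ≤ b)
    (E : Matrix (Fin W) (Fin W) ℝ) (hE : E = B * R * Bᵀ)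
    (d : ℝ) (hd : d = (1 - b) ^ 2 * lammin ^ 2 / lammax)
    (Ehat : Matrix (Fin W) (Fin W) ℝ)
    (hEhat : ∀ u v, |Ehat u v - E u v| < d / 8)
    (i : Fin W) (k : Fin K) (hi : IsNovelRow B i k) :
    ∀ j : Fin W,
      (d / 2 ≤ Ehat i i - Ehat i j - Ehat j i + Ehat j j) ↔ ¬ IsNovelRow B j k := by
  intro j
  have hq : E i i - E i j - E j i + E j j
      = (B i - B j) ⬝ᵥ R.mulVec (B i - B j) := by
    have key : ∀ u v, E u v = B u ⬝ᵥ R.mulVec (B v) := by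
      intro u v
      rw [hE, Matrix.mul_assoc]
      rfl
    simp only [key, Matrix.mulVec_sub, dotProduct_sub, sub_dotProduct]
    ring
  have h1 := abs_lt.mp (hEhat i i)
  have h2 := abs_lt.mp (hEhat i j)
  have h3 := abs_lt.mp (hEhat j i)
  have h4 := abs_lt.mp (hEhat j j)
  constructor
  · intro h hj
    have hx : B i - B j = 0 := by
      funext l
      simp [hi l, hj l]
    rw [hx] at hq
    simp only [zero_dotProduct] at hq
    linarith [h1.1, h1.2, h2.1, h2.2, h3.1, h3.2, h4.1, h4.2]
  · intro hj
    have hBk : B j k ≤ b := by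
      by_cases hn : ∃ k', IsNovelRow B j k'
      · obtain ⟨k', hk'⟩ := hn
        have hne : k ≠ k' := by
          rintro rfl
          exact hj hk'
        rw [hk' k, if_neg hne]
        exact hb0
      · exact hbmax j k (not_exists.mp hn)
    have hll : lammin ≤ lammax := by
      have h := (hmin (B i)).trans (hmax (B i))
      have hs : ∑ l, B i l ^ 2 = 1 := by
        simp [hi _]
      rw [hs] at h
      linarith
    have hpos : 0 < lammax := hlammin.trans_le hll
    have hsum : (1 - b) ^ 2 ≤ ∑ l, (B i - B j) l ^ 2 := by
      have h := Finset.single_le_sum (f := fun l => (B i - B j) l ^ 2)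
        (fun l _ => sq_nonneg _) (Finset.mem_univ k)
      refine le_trans ?_ h
      have : (B i - B j) k = 1 - B j k := by simp [hi k]
      simp only [this]
      exact pow_le_pow_left₀ (by linarith) (by linarith) 2
    have hdle : d ≤ lammin * (1 - b) ^ 2 := by
      rw [hd, div_le_iff₀ hpos]
      have := mul_le_mul_of_nonneg_left hll
        (mul_nonneg (sq_nonneg (1 - b)) hlammin.le)
      nlinarith
    have hm := hmin (B i - B j)
    have := mul_le_mul_of_nonneg_left hsum hlammin.le
    linarith [h1.1, h1.2, h2.1, h2.2, h3.1, h3.2, h4.1, h4.2]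
end

section
/- Assume B̄ is separable and R̄ is symmetric positive definite, and let μ be an isotropic Borel probability measure on ℝ^W with μ({0}) = 0. For each row index i define the normalized solid angle q_i = μ{ d ∈ ℝ^W : for every j with E_j ≠ E_i, ⟨E_i, d⟩ > ⟨E_j, d⟩ }. Then q_i > 0 if and only if i is a novel row (i.e., i ∈ C_k for some k). -/
open Matrix MeasureTheory
open scoped RealInnerProductSpace

theorem iso_cone_pos {V : Type*} [NormedAddCommGroup V] [InnerProductSpace ℝ V]
    [FiniteDimensional ℝ V] [MeasurableSpace V] [BorelSpace V]
    (μ : Measure V) [IsProbabilityMeasure μ]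
    (hiso : ∀ f : V ≃ₗᵢ[ℝ] V, Measure.map f μ = μ) (h0 : μ {0} = 0)
    (C : Set V) (hC : IsOpen C) (hs : ∀ (t : ℝ), 0 < t → ∀ x ∈ C, t • x ∈ C)
    (c : V) (hc : c ∈ C) (hc0 : c ≠ 0) : 0 < μ C := by
  rw [pos_iff_ne_zero]
  intro hz
  have h1 : μ ({0}ᶜ : Set V) = 0 := by
    apply measure_null_of_locally_null
    intro x hx
    have hx0 : x ≠ 0 := hx
    have hcn : 0 < ‖c‖ := norm_pos_iff.2 hc0
    have hxn : 0 < ‖x‖ := norm_pos_iff.2 hx0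
    set c' : V := (‖x‖ / ‖c‖) • c with hc'
    have hc'C : c' ∈ C := hs _ (by positivity) _ hc
    have hn : ‖x‖ = ‖c'‖ := by
      rw [hc', norm_smul, Real.norm_of_nonneg (by positivity)]
      field_simp
    have hf := Submodule.reflection_sub hn
    set f : V ≃ₗᵢ[ℝ] V := Submodule.reflection (ℝ ∙ (x - c'))ᗮ with hfdef
    refine ⟨f ⁻¹' C, mem_nhdsWithin_of_mem_nhds
      ((hC.preimage f.continuous).mem_nhds (by rw [Set.mem_preimage, hf]; exact hc'C)), ?_⟩
    rw [← Measure.map_apply f.continuous.measurable hC.measurableSet, hiso f, hz]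
  have h2 : μ Set.univ = 0 := by
    rw [← Set.union_compl_self ({0} : Set V)]
    exact measure_union_null h0 h1
  simp at h2

/-- For an isotropic Borel probability measure `μ` on `ℝ^W` with `μ({0}) = 0`,
the normalized solid angle
`q_i = μ{ d : ⟨E_i, d⟩ > ⟨E_j, d⟩ for every j with E_j ≠ E_i }` of row `i` of
`E = B̄·R̄·B̄ᵀ` is positive if and only if `i` is a novel row. -/
theorem solid_angle_pos_iff_novel
    (W K : ℕ) (hKW : K ≤ W)
    (B : Matrix (Fin W) (Fin K) ℝ)
    (hBnn : ∀ i k, 0 ≤ B i k) (hBrow : ∀ i, ∑ k, B i k = 1)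
    (hsep : ∀ k, ∃ i, IsNovelRow B i k)
    (R : Matrix (Fin K) (Fin K) ℝ) (hRsymm : R.IsSymm) (hR : R.PosDef)
    (E : Matrix (Fin W) (Fin W) ℝ) (hE : E = B * R * Bᵀ)
    (Erow : Fin W → EuclideanSpace ℝ (Fin W)) (hErow : ∀ i l, Erow i l = E i l)
    (μ : Measure (EuclideanSpace ℝ (Fin W))) [IsProbabilityMeasure μ]
    (hiso : ∀ f : EuclideanSpace ℝ (Fin W) ≃ₗᵢ[ℝ] EuclideanSpace ℝ (Fin W),
      Measure.map f μ = μ)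
    (h0 : μ {0} = 0)
    (i : Fin W) :
    0 < μ {d | ∀ j : Fin W, Erow j ≠ Erow i → ⟪Erow j, d⟫ < ⟪Erow i, d⟫} ↔
      ∃ k, IsNovelRow B i k := by
  choose n hn using hsep
  have hin : ∀ j d, ⟪Erow j, d⟫ = ∑ l, B j l * (R *ᵥ (Bᵀ *ᵥ d.ofLp)) l := by
    intro j d
    have h1 : ⟪Erow j, d⟫ = (E *ᵥ d.ofLp) j := by
      simp only [PiLp.inner_apply, mulVec, dotProduct, hErow]
      exact Finset.sum_congr rfl fun l _ => by simp [mul_comm]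
    rw [h1, hE, ← mulVec_mulVec, ← mulVec_mulVec]
    rfl
  have hsurj : ∀ v : Fin K → ℝ, ∃ d : EuclideanSpace ℝ (Fin W), R *ᵥ (Bᵀ *ᵥ d.ofLp) = v := by
    intro v
    have hdet : IsUnit R.det := isUnit_iff_ne_zero.2 hR.det_pos.ne'
    refine ⟨WithLp.toLp 2 (∑ l, Pi.single (n l) ((R⁻¹ *ᵥ v) l)), ?_⟩
    have h2 : Bᵀ *ᵥ (∑ l, Pi.single (n l) ((R⁻¹ *ᵥ v) l)) = R⁻¹ *ᵥ v := by
      rw [mulVec_sum]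
      ext m
      simp only [Finset.sum_apply, mulVec_single]
      simp [hn _ _]
    simp only
    rw [h2, mulVec_mulVec, mul_nonsing_inv R hdet, one_mulVec]
  have hinj : ∀ j, Erow j = Erow i → ∀ l, B j l = B i l := by
    intro j hj l
    obtain ⟨d, hd⟩ := hsurj (Pi.single l 1)
    have h1 := hin j d
    rw [hj, hin i d, hd] at h1
    simpa [Pi.single_apply] using h1.symm
  constructor
  · intro hpos
    obtain ⟨d, hd⟩ := nonempty_of_measure_ne_zero hpos.ne'
    by_contra hno
    push Not at hno
    have hlt : ∀ k, (R *ᵥ (Bᵀ *ᵥ d.ofLp)) k < ⟪Erow i, d⟫ := by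
      intro k
      have h1 := hd (n k) (fun h => hno k (fun l => by rw [← hinj _ h l, hn k l]))
      rw [hin (n k) d] at h1
      simpa [hn k _] using h1
    have hex : ∃ k, 0 < B i k := by
      by_contra! hcon
      have h1 : ∑ k, B i k ≤ 0 := Finset.sum_nonpos fun k _ => hcon k
      rw [hBrow] at h1
      linarith
    obtain ⟨k, hk⟩ := hex
    have h1 : ∑ l, B i l * (R *ᵥ (Bᵀ *ᵥ d.ofLp)) l < ∑ l, B i l * ⟪Erow i, d⟫ :=
      Finset.sum_lt_sum (fun l _ => mul_le_mul_of_nonneg_left (hlt l).le (hBnn i l))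
        ⟨k, Finset.mem_univ _, mul_lt_mul_of_pos_left (hlt k) hk⟩
    rw [← Finset.sum_mul, hBrow, one_mul, ← hin] at h1
    exact lt_irrefl _ h1
  · rintro ⟨k, hk⟩
    obtain ⟨d, hd⟩ := hsurj (Pi.single k 1)
    have hval : ∀ j, ⟪Erow j, d⟫ = B j k := by
      intro j
      rw [hin j d, hd]
      simp [Pi.single_apply]
    have hik : B i k = 1 := by simp [hk k]
    refine iso_cone_pos μ hiso h0 _ ?_ ?_ d ?_ ?_
    · simp only [Set.setOf_forall]
      refine isOpen_iInter_of_finite fun j => isOpen_iInter_of_finite fun _ => ?_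
      exact isOpen_lt (by fun_prop) (by fun_prop)
    · intro t ht x hx j hj
      rw [inner_smul_right, inner_smul_right]
      exact mul_lt_mul_of_pos_left (hx j hj) ht
    · intro j hj
      rw [hval, hval, hik]
      by_contra! hge
      apply hj
      have hrest : ∀ l, l ≠ k → B j l = 0 := by
        intro l hl
        have h1 := Finset.add_le_sum (fun m _ => hBnn j m) (Finset.mem_univ l)
          (Finset.mem_univ k) hl
        rw [hBrow] at h1
        linarith [hBnn j l]
      have hjk : B j k = 1 := by
        rw [← hBrow j]
        exact (Finset.sum_eq_single k (fun l _ hl => hrest l hl) (by simp)).symm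
      have hrow : B j = B i := by
        ext l
        rw [hk l]
        split_ifs with h
        · rw [h, hjk]
        · exact hrest l h
      ext l
      rw [hErow, hErow, hE]
      simp only [mul_apply, hrow]
    · rintro rfl
      have h1 := hval i
      rw [inner_zero_right, hik] at h1
      norm_num at h1
end

section
/- Assume B̄ is separable and R̄ is symmetric positive definite. Then a row E_i of E = B̄·R̄·B̄ᵀ is an extreme point of the convex hull of the set of all rows {E_1, …, E_W} if and only if i is a novel row (i.e., i ∈ C_k for some k ∈ {1,…,K}). -/
open Matrix

/-- A row `E_i` of `E = B̄·R̄·B̄ᵀ` is an extreme point of the convex hull of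
the set of all rows of `E` if and only if `i` is a novel row. -/
theorem extreme_point_iff_novel
    (W K : ℕ) (hKW : K ≤ W)
    (B : Matrix (Fin W) (Fin K) ℝ)
    (hBnn : ∀ i k, 0 ≤ B i k) (hBrow : ∀ i, ∑ k, B i k = 1)
    (hsep : ∀ k, ∃ i, IsNovelRow B i k)
    (hnonnovel : ∀ j : Fin W, (∀ k, ¬ IsNovelRow B j k) →
      ∀ k : Fin K, ∃ l, B j l ≠ if l = k then 1 else 0)
    (R : Matrix (Fin K) (Fin K) ℝ) (hRsymm : R.IsSymm) (hR : R.PosDef)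
    (E : Matrix (Fin W) (Fin W) ℝ) (hE : E = B * R * Bᵀ)
    (i : Fin W) :
    E i ∈ Set.extremePoints ℝ (convexHull ℝ (Set.range fun j : Fin W => E j)) ↔
      ∃ k, IsNovelRow B i k := by
  obtain ⟨f, hf⟩ : ∃ f : (Fin K → ℝ) →ₗ[ℝ] (Fin W → ℝ), ∀ v, f v = v ᵥ* (R * Bᵀ) :=
    ⟨Matrix.vecMulLinear (R * Bᵀ), fun v => rfl⟩
  have hfE : ∀ j, E j = f (B j) := by
    intro j
    rw [hf, hE, Matrix.mul_assoc]
    rfl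
  have hinj : Function.Injective f := by
    rw [injective_iff_map_eq_zero]
    intro v hv
    rw [hf, ← Matrix.vecMul_vecMul] at hv
    have h1 : v ᵥ* R = 0 := by
      funext k
      obtain ⟨j, hj⟩ := hsep k
      have h2 := congrFun hv j
      have h3 : B j = fun l => if l = k then (1 : ℝ) else 0 := funext hj
      simpa [Matrix.vecMul, dotProduct, Matrix.transpose_apply, h3] using h2
    have hu : IsUnit R := hR.isUnit
    exact Matrix.vecMul_injective_of_isUnit hu (by simpa using h1)
  let e : Fin K → (Fin K → ℝ) := fun k l => if l = k then 1 else 0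
  have hnov : ∀ j k, IsNovelRow B j k ↔ B j = e k := fun j k => ⟨fun h => funext h, fun h l => congrFun h l⟩
  have he : convexHull ℝ (Set.range e) = stdSimplex ℝ (Fin K) := by
    rw [← convexHull_basis_eq_stdSimplex]
    congr! 5
    exact eq_comm
  have hB : convexHull ℝ (Set.range B) = stdSimplex ℝ (Fin K) := by
    apply Set.Subset.antisymm
    · apply convexHull_min _ (convex_stdSimplex ℝ (Fin K))
      rintro _ ⟨j, rfl⟩
      exact ⟨hBnn j, hBrow j⟩
    · rw [← he]
      apply convexHull_mono
      rintro _ ⟨k, rfl⟩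
      obtain ⟨j, hj⟩ := hsep k
      exact ⟨j, (hnov j k).1 hj⟩
  have hrange : (Set.range fun j : Fin W => E j) = f '' Set.range B := by
    ext x
    constructor
    · rintro ⟨j, rfl⟩
      exact ⟨B j, ⟨j, rfl⟩, (hfE j).symm⟩
    · rintro ⟨_, ⟨j, rfl⟩, rfl⟩
      exact ⟨j, hfE j⟩
  have hhull : convexHull ℝ (Set.range fun j : Fin W => E j) = f '' stdSimplex ℝ (Fin K) := by
    rw [hrange, ← f.image_convexHull, hB]
  rw [hhull]
  constructor
  · intro h
    rw [← he, f.image_convexHull] at h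
    obtain ⟨_, ⟨k, rfl⟩, hk⟩ := extremePoints_convexHull_subset h
    refine ⟨k, (hnov i k).2 (hinj ?_)⟩
    rw [← hfE, hk]
  · rintro ⟨k, hk⟩
    refine ⟨⟨B i, ⟨hBnn i, hBrow i⟩, (hfE i).symm⟩, ?_⟩
    rintro _ ⟨a, ha, rfl⟩ _ ⟨b, hb, rfl⟩ ⟨s, t, hs, ht, hst, h⟩
    rw [hfE i, ← map_smul, ← map_smul, ← map_add] at h
    have h := hinj h
    have h0 : ∀ l, l ≠ k → a l = 0 := by
      intro l hl
      have h1 := congrFun h l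
      rw [hk l, if_neg hl] at h1
      simp only [Pi.add_apply, Pi.smul_apply, smul_eq_mul] at h1
      have := mul_nonneg hs.le (ha.1 l)
      have := mul_nonneg ht.le (hb.1 l)
      have h2 : s * a l = 0 := by linarith
      exact (mul_eq_zero.1 h2).resolve_left hs.ne'
    have h1 : a k = 1 := by
      rw [← ha.2]
      exact (Finset.sum_eq_single k (fun l _ hl => h0 l hl) (by simp)).symm
    rw [hfE i]
    congr 1
    funext l
    rw [hk l]
    split_ifs with hl
    · rw [hl, h1]
    · exact h0 l hl
end

section
/- Let n ≥ 2 and let μ be an isotropic Borel probability measure on ℝⁿ with μ({0}) = 0. Let J be a finite index set and let (z_j)_{j∈J} and (ẑ_j)_{j∈J} be families of nonzero vectors in ℝⁿ. Then μ{ d : ⟨z_j, d⟩ ≥ 0 for all j ∈ J } − μ{ d : ⟨ẑ_j, d⟩ ≥ 0 for all j ∈ J } ≤ Σ_{j∈J} φ_j/(2π), where φ_j ∈ [0,π] is the angle between z_j and ẑ_j. -/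
open MeasureTheory
open scoped RealInnerProductSpace

lemma arc_aux (θ φ : ℝ) (h0 : 0 ≤ φ) (hπ : φ ≤ Real.pi) :
    volume ({t : ℝ | 0 ≤ Real.cos (t - θ) ∧ Real.cos (t - θ - φ) < 0} ∩ Set.Ioc 0 (0 + 2 * Real.pi))
      ≤ ENNReal.ofReal φ := by
  have hpi := Real.pi_pos
  have hm : MeasurableSet {t : ℝ | 0 ≤ Real.cos (t - θ) ∧ Real.cos (t - θ - φ) < 0} :=
    MeasurableSet.inter (s₁ := {t : ℝ | 0 ≤ Real.cos (t - θ)}) (s₂ := {t : ℝ | Real.cos (t - θ - φ) < 0})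
      (measurableSet_le (by fun_prop) (by fun_prop)) (measurableSet_lt (by fun_prop) (by fun_prop))
  have h2 : (0:ℝ) < 2 * Real.pi := by positivity
  have key := (isAddFundamentalDomain_Ioc h2 0 volume).measure_set_eq
    (isAddFundamentalDomain_Ioc h2 (θ - Real.pi) volume) hm (by
      rintro ⟨g, hg⟩
      obtain ⟨k, rfl⟩ := AddSubgroup.mem_zmultiples_iff.1 hg
      ext t
      have e1 : (k • (2 * Real.pi) + t) - θ = (t - θ) + k * (2 * Real.pi) := by
        simp; ring
      have e2 : (k • (2 * Real.pi) + t) - θ - φ = (t - θ - φ) + k * (2 * Real.pi) := by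
        simp; ring
      simp only [Set.mem_preimage, Set.mem_ofPred_eq, AddSubgroup.vadd_def, vadd_eq_add]
      rw [e2, e1, Real.cos_add_int_mul_two_pi, Real.cos_add_int_mul_two_pi])
  rw [key]
  calc _ ≤ volume (Set.Ico (θ - Real.pi / 2) (θ - Real.pi / 2 + φ)) := by
        apply measure_mono
        rintro t ⟨⟨h1, h2⟩, h3, h4⟩
        have a1 : θ - Real.pi / 2 ≤ t := by
          by_contra! h
          have : Real.cos (t - θ + 2 * Real.pi) < 0 :=
            Real.cos_neg_of_pi_div_two_lt_of_lt (by linarith) (by linarith)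
          rw [Real.cos_add_two_pi] at this
          linarith
        have a2 : t ≤ θ + Real.pi / 2 := by
          by_contra! h
          have : Real.cos (t - θ) < 0 :=
            Real.cos_neg_of_pi_div_two_lt_of_lt (by linarith) (by linarith)
          linarith
        refine ⟨a1, ?_⟩
        by_contra! h
        have : 0 ≤ Real.cos (t - θ - φ) :=
          Real.cos_nonneg_of_neg_pi_div_two_le_of_le (by linarith) (by linarith)
        linarith
    _ = ENNReal.ofReal φ := by rw [Real.volume_Ico]; congr 1; ring

lemma exists_orth {n : ℕ} (hn : 2 ≤ n) (e : EuclideanSpace ℝ (Fin n)) :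
    ∃ f : EuclideanSpace ℝ (Fin n), ‖f‖ = 1 ∧ ⟪e, f⟫ = 0 := by
  have h1 := Submodule.finrank_add_finrank_orthogonal (ℝ ∙ e)
  have h2 := finrank_span_le_card (R := ℝ) ({e} : Set (EuclideanSpace ℝ (Fin n)))
  simp only [Set.toFinset_singleton, Finset.card_singleton] at h2
  rw [finrank_euclideanSpace_fin] at h1
  have h3 : 0 < Module.finrank ℝ (ℝ ∙ e)ᗮ := by omega
  haveI := Module.finrank_pos_iff.1 h3
  obtain ⟨f, hf⟩ := exists_norm_eq (ℝ ∙ e)ᗮ (zero_le_one (α := ℝ))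
  exact ⟨f, by simpa using hf, Submodule.mem_orthogonal_singleton_iff_inner_right.1 f.2⟩

lemma exists_frame {n : ℕ} (hn : 2 ≤ n) (a b : EuclideanSpace ℝ (Fin n)) (φ : ℝ)
    (ha : ‖a‖ = 1) (hb : ‖b‖ = 1) (hab : ⟪a, b⟫ = Real.cos φ) :
    ∃ f : EuclideanSpace ℝ (Fin n), ‖f‖ = 1 ∧ ⟪a, f⟫ = 0 ∧ b = Real.cos φ • a + Real.sin φ • f := by
  have haa : ⟪a, a⟫ = 1 := by rw [real_inner_self_eq_norm_sq, ha]; norm_num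
  have hnorm : ‖b - Real.cos φ • a‖ ^ 2 = Real.sin φ ^ 2 := by
    rw [norm_sub_sq_real, norm_smul, inner_smul_right, real_inner_comm, hab, ha, hb,
      Real.sin_sq, Real.norm_eq_abs, mul_one, sq_abs]
    ring
  by_cases hs : Real.sin φ = 0
  · obtain ⟨f, hf, hf'⟩ := exists_orth hn a
    refine ⟨f, hf, hf', ?_⟩
    rw [hs] at hnorm ⊢
    have : b - Real.cos φ • a = 0 := by simpa using hnorm
    rw [sub_eq_zero] at this
    simpa using this
  · refine ⟨(Real.sin φ)⁻¹ • (b - Real.cos φ • a), ?_, ?_, ?_⟩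
    · rw [← sq_eq_sq₀ (norm_nonneg _) zero_le_one, norm_smul, mul_pow, hnorm, norm_inv, inv_pow,
        Real.norm_eq_abs, sq_abs]
      field_simp
    · rw [inner_smul_right, inner_sub_right, inner_smul_right, haa, hab]; simp
    · rw [smul_smul, mul_inv_cancel₀ hs]; simp

lemma wedge_bound {n : ℕ} (hn : 2 ≤ n)
    (μ : Measure (EuclideanSpace ℝ (Fin n))) [IsProbabilityMeasure μ]
    (hiso : ∀ f : EuclideanSpace ℝ (Fin n) ≃ₗᵢ[ℝ] EuclideanSpace ℝ (Fin n),
      Measure.map f μ = μ)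
    (a b : EuclideanSpace ℝ (Fin n)) (φ : ℝ) (h0 : 0 ≤ φ) (hπ : φ ≤ Real.pi)
    (ha : ‖a‖ = 1) (hb : ‖b‖ = 1) (hab : ⟪a, b⟫ = Real.cos φ) :
    μ {d | 0 ≤ ⟪a, d⟫ ∧ ⟪b, d⟫ < 0} ≤ ENNReal.ofReal (φ / (2 * Real.pi)) := by
  obtain ⟨f, hf, haf, hbf⟩ := exists_frame hn a b φ ha hb hab
  have hpi := Real.pi_pos
  have haa : ⟪a, a⟫ = 1 := by rw [real_inner_self_eq_norm_sq, ha]; norm_num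
  have hff : ⟪f, f⟫ = 1 := by rw [real_inner_self_eq_norm_sq, hf]; norm_num
  have hfa : ⟪f, a⟫ = 0 := by rw [real_inner_comm, haf]
  set A : Set (EuclideanSpace ℝ (Fin n)) := {d | 0 ≤ ⟪a, d⟫ ∧ ⟪b, d⟫ < 0} with hA
  have hAm : MeasurableSet A :=
    MeasurableSet.inter (s₁ := {d | 0 ≤ ⟪a, d⟫}) (s₂ := {d | ⟪b, d⟫ < 0})
      (measurableSet_le (by fun_prop) (by fun_prop)) (measurableSet_lt (by fun_prop) (by fun_prop))
  let v : ℝ → EuclideanSpace ℝ (Fin n) := fun t => Real.cos (t / 2) • a + Real.sin (t / 2) • f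
  have hv : ∀ t, ‖v t‖ = 1 := by
    intro t
    rw [← sq_eq_sq₀ (norm_nonneg _) zero_le_one, ← real_inner_self_eq_norm_sq]
    simp only [v, inner_add_left, inner_add_right, inner_smul_left, inner_smul_right, haa, hff,
      haf, hfa]
    simp
    nlinarith [Real.sin_sq_add_cos_sq (t / 2)]
  let R : ℝ → EuclideanSpace ℝ (Fin n) → EuclideanSpace ℝ (Fin n) :=
    fun t d => (2 * ⟪v t, d⟫) • v t - d
  have hR : ∀ t, μ (R t ⁻¹' A) = μ A := by
    intro t
    have e : R t = (Submodule.reflection (ℝ ∙ v t)) := by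
      ext1 d
      rw [Submodule.reflection_singleton_apply, hv t]
      simp [R, mul_smul, two_smul]
    rw [e]
    conv_rhs => rw [← hiso (Submodule.reflection (ℝ ∙ v t))]
    rw [Measure.map_apply (LinearIsometryEquiv.continuous _).measurable hAm]
  have hRc : Continuous (fun p : ℝ × EuclideanSpace ℝ (Fin n) => R p.1 p.2) := by
    simp only [R, v]; fun_prop
  set S : Set (ℝ × EuclideanSpace ℝ (Fin n)) := (fun p => R p.1 p.2) ⁻¹' A with hS
  have hSm : MeasurableSet S := hRc.measurable hAm
  set I : Set ℝ := Set.Ioc 0 (0 + 2 * Real.pi) with hI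
  have e1 : ((volume.restrict I).prod μ) S = μ A * ENNReal.ofReal (2 * Real.pi) := by
    rw [Measure.prod_apply hSm]
    have : ∀ t, μ (Prod.mk t ⁻¹' S) = μ A := fun t => hR t
    simp only [this, lintegral_const, Measure.restrict_apply MeasurableSet.univ, Set.univ_inter]
    rw [hI, Real.volume_Ioc]; simp
  have e2 : ((volume.restrict I).prod μ) S ≤ ENNReal.ofReal φ := by
    rw [Measure.prod_apply_symm hSm]
    have : ∀ d, (volume.restrict I) ((fun t => (t, d)) ⁻¹' S) ≤ ENNReal.ofReal φ := by
      intro d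
      rw [Measure.restrict_apply (measurable_prodMk_right hSm)]
      let w : ℂ := ⟨⟪a, d⟫, ⟪f, d⟫⟩
      have hx : ⟪a, d⟫ = ‖w‖ * Real.cos w.arg := (Complex.norm_mul_cos_arg w).symm
      have hy : ⟪f, d⟫ = ‖w‖ * Real.sin w.arg := (Complex.norm_mul_sin_arg w).symm
      have hr : 0 ≤ ‖w‖ := norm_nonneg w
      refine le_trans (measure_mono ?_) (arc_aux w.arg φ h0 hπ)
      generalize ‖w‖ = r at *
      generalize w.arg = θ at *
      refine Set.inter_subset_inter_left _ ?_
      rintro t ⟨h1, h2⟩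
      have hc : Real.cos t = 2 * Real.cos (t/2) ^ 2 - 1 := by
        rw [← Real.cos_two_mul]; congr 1; ring
      have hs : Real.sin t = 2 * Real.sin (t/2) * Real.cos (t/2) := by
        rw [← Real.sin_two_mul]; congr 1; ring
      have hsc := Real.sin_sq_add_cos_sq (t / 2)
      have c1 : ⟪a, R t d⟫ = r * Real.cos (t - θ) := by
        simp only [R, v, inner_add_left, inner_add_right, inner_sub_right, real_inner_smul_left,
          real_inner_smul_right, haa, haf, hx, hy, Real.cos_sub, hc, hs]
        ring
      have c2 : ⟪f, R t d⟫ = r * Real.sin (t - θ) := by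
        simp only [R, v, inner_add_left, inner_add_right, inner_sub_right, real_inner_smul_left,
          real_inner_smul_right, hff, hfa, hx, hy, Real.sin_sub, hc, hs]
        linear_combination (2 * r * Real.sin θ) * hsc
      have c3 : ⟪b, R t d⟫ = r * Real.cos (t - θ - φ) := by
        rw [hbf, inner_add_left, real_inner_smul_left, real_inner_smul_left, c1, c2,
          Real.cos_sub (t - θ)]
        ring
      simp only at h1 h2
      rw [c1] at h1
      rw [c3] at h2
      have hr' : 0 < r := by
        rcases hr.eq_or_lt with h | h
        · rw [← h] at h2; simp at h2
        · exact h
      exact ⟨nonneg_of_mul_nonneg_right h1 hr', by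
        by_contra! h; exact absurd (mul_nonneg hr h) (not_le.2 h2)⟩
    calc _ ≤ ∫⁻ _, ENNReal.ofReal φ ∂μ := lintegral_mono this
      _ = _ := by simp
  rw [e1] at e2
  rw [ENNReal.ofReal_div_of_pos (by positivity)]
  rw [ENNReal.le_div_iff_mul_le]
  · exact e2
  · left; simpa using hpi
  · left; exact ENNReal.ofReal_ne_top

/-- Perturbation bound for solid angles under an isotropic measure.
For families `(z_j)` and `(ẑ_j)` of nonzero vectors indexed by a finite set `J`,
`μ{ d : ⟨z_j,d⟩ ≥ 0 ∀ j } − μ{ d : ⟨ẑ_j,d⟩ ≥ 0 ∀ j } ≤ Σ_j φ_j/(2π)`,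
where `φ_j = arccos(⟨z_j,ẑ_j⟫/(‖z_j‖·‖ẑ_j‖))` is the angle between `z_j` and `ẑ_j`. -/
theorem isotropic_solid_angle_perturbation
    (n : ℕ) (hn : 2 ≤ n)
    (μ : Measure (EuclideanSpace ℝ (Fin n))) [IsProbabilityMeasure μ]
    (hiso : ∀ f : EuclideanSpace ℝ (Fin n) ≃ₗᵢ[ℝ] EuclideanSpace ℝ (Fin n),
      Measure.map f μ = μ)
    (h0 : μ {0} = 0)
    (ι : Type*) (J : Finset ι)
    (z zhat : ι → EuclideanSpace ℝ (Fin n))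
    (hz : ∀ j ∈ J, z j ≠ 0) (hzhat : ∀ j ∈ J, zhat j ≠ 0) :
    μ {d | ∀ j ∈ J, 0 ≤ ⟪z j, d⟫} - μ {d | ∀ j ∈ J, 0 ≤ ⟪zhat j, d⟫} ≤
      ENNReal.ofReal
        (∑ j ∈ J, Real.arccos (⟪z j, zhat j⟫ / (‖z j‖ * ‖zhat j‖)) / (2 * Real.pi)) := by
  have hpi := Real.pi_pos
  rw [tsub_le_iff_right, ENNReal.ofReal_sum_of_nonneg
    (fun j _ => div_nonneg (Real.arccos_nonneg _) (by positivity))]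
  have hw : ∀ j ∈ J, μ {d | 0 ≤ ⟪z j, d⟫ ∧ ⟪zhat j, d⟫ < 0} ≤ ENNReal.ofReal
      (Real.arccos (⟪z j, zhat j⟫ / (‖z j‖ * ‖zhat j‖)) / (2 * Real.pi)) := by
    intro j hj
    have p1 : 0 < ‖z j‖ := norm_pos_iff.2 (hz j hj)
    have p2 : 0 < ‖zhat j‖ := norm_pos_iff.2 (hzhat j hj)
    have hab := abs_le.1 (abs_real_inner_div_norm_mul_norm_le_one (z j) (zhat j))
    have := wedge_bound hn μ hiso (‖z j‖⁻¹ • z j) (‖zhat j‖⁻¹ • zhat j)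
      (Real.arccos (⟪z j, zhat j⟫ / (‖z j‖ * ‖zhat j‖)))
      (Real.arccos_nonneg _) (Real.arccos_le_pi _)
      (by rw [norm_smul, norm_inv, norm_norm, inv_mul_cancel₀ p1.ne'])
      (by rw [norm_smul, norm_inv, norm_norm, inv_mul_cancel₀ p2.ne'])
      (by rw [Real.cos_arccos hab.1 hab.2, real_inner_smul_left, real_inner_smul_right]
          field_simp)
    refine le_trans (measure_mono ?_) this
    rintro d ⟨h1, h2⟩
    refine ⟨?_, ?_⟩
    · rw [real_inner_smul_left]; exact mul_nonneg (inv_nonneg.2 p1.le) h1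
    · rw [real_inner_smul_left]; exact mul_neg_of_pos_of_neg (inv_pos.2 p2) h2
  calc _ ≤ μ ((⋃ j ∈ J, {d | 0 ≤ ⟪z j, d⟫ ∧ ⟪zhat j, d⟫ < 0}) ∪
        {d | ∀ j ∈ J, 0 ≤ ⟪zhat j, d⟫}) := by
        apply measure_mono
        intro d hd
        by_cases h : ∀ j ∈ J, 0 ≤ ⟪zhat j, d⟫
        · exact Or.inr h
        · push Not at h
          obtain ⟨j, hj, h⟩ := h
          left
          simp only [Set.mem_iUnion]
          exact ⟨j, hj, hd j hj, h⟩
    _ ≤ _ := (measure_union_le _ _).trans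
        (by gcongr; exact (measure_biUnion_finset_le _ _).trans (Finset.sum_le_sum hw))
end

section
/- Assume rows 1,…,K of B̄ are e_1ᵀ,…,e_Kᵀ respectively (so B̄ is separable with row k novel for ranking k, and E_k = (R̄B̄ᵀ)_k for k ≤ K). Let Ê be any W×W real matrix. Fix a row index i, let b* = B̄_i ∈ Δᴷ (so E_i = Σ_{k=1}^{K} b*_k E_k), and let b̂ be any minimizer over the simplex Δᴷ = {b ∈ ℝᴷ : b_k ≥ 0, Σ b_k = 1} of the function b ↦ ‖Ê_i − Σ_{k=1}^{K} b_k Ê_k‖₂. Then ‖b̂ − b*‖₂ ≤ (4·√W / λ_min) · max_{u,v} |Ê_{u,v} − E_{u,v}|. -/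
open Matrix

/-- Stability of the constrained linear regression step.
Assume rows `1,…,K` of the row-stochastic matrix `B̄` are the standard basis vectors
`e_1ᵀ,…,e_Kᵀ` and `E = B̄·R̄·B̄ᵀ`. If `b̂` minimizes `b ↦ ‖Ê_i − Σ_k b_k Ê_k‖₂` over the
simplex, and `b* = B̄_i`, then `‖b̂ − b*‖₂ ≤ (4·√W/λ_min)·max_{u,v}|Ê_{u,v} − E_{u,v}|`. -/
theorem constrained_regression_stability
    (W K : ℕ) (hKW : K ≤ W)
    (B : Matrix (Fin W) (Fin K) ℝ)
    (hBnn : ∀ i k, 0 ≤ B i k) (hBrow : ∀ i, ∑ k, B i k = 1)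
    (hId : ∀ k l : Fin K, B (Fin.castLE hKW k) l = if l = k then 1 else 0)
    (R : Matrix (Fin K) (Fin K) ℝ) (hRsymm : R.IsSymm) (hR : R.PosDef)
    (lammin : ℝ) (hlammin : 0 < lammin)
    (hmin : ∀ x : Fin K → ℝ, lammin * ∑ k, x k ^ 2 ≤ x ⬝ᵥ R.mulVec x)
    (E Ehat : Matrix (Fin W) (Fin W) ℝ) (hE : E = B * R * Bᵀ)
    (ε : ℝ) (hEhat : ∀ u v, |Ehat u v - E u v| ≤ ε)
    (i : Fin W)
    (bhat : Fin K → ℝ) (hbhat_nn : ∀ k, 0 ≤ bhat k) (hbhat_sum : ∑ k, bhat k = 1)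
    (hbhat_min : ∀ c : Fin K → ℝ, (∀ k, 0 ≤ c k) → (∑ k, c k = 1) →
      Real.sqrt (∑ l, (Ehat i l - ∑ k, bhat k * Ehat (Fin.castLE hKW k) l) ^ 2) ≤
        Real.sqrt (∑ l, (Ehat i l - ∑ k, c k * Ehat (Fin.castLE hKW k) l) ^ 2)) :
    Real.sqrt (∑ k, (bhat k - B i k) ^ 2) ≤ 4 * Real.sqrt W / lammin * ε := by
  have hε : 0 ≤ ε := le_trans (abs_nonneg _) (hEhat i i)
  set G : Matrix (Fin K) (Fin W) ℝ := R * Bᵀ with hG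
  have hEG : ∀ u l, E u l = ∑ m, B u m * G m l := by
    intro u l
    rw [hE, Matrix.mul_assoc, Matrix.mul_apply]
  have hEk : ∀ (k : Fin K) l, E (Fin.castLE hKW k) l = G k l := by
    intro k l
    rw [hEG]; simp [hId]
  have hGk : ∀ m k : Fin K, G m (Fin.castLE hKW k) = R m k := by
    intro m k
    rw [hG, Matrix.mul_apply]; simp [hId]
  -- entrywise perturbation of the residual
  have hpert : ∀ c : Fin K → ℝ, (∀ k, 0 ≤ c k) → (∑ k, c k = 1) → ∀ l,
      |(Ehat i l - ∑ k, c k * Ehat (Fin.castLE hKW k) l)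
        - ∑ k, (B i k - c k) * G k l| ≤ 2 * ε := by
    intro c hc hs l
    have e1 : (Ehat i l - ∑ k, c k * Ehat (Fin.castLE hKW k) l)
        - ∑ k, (B i k - c k) * G k l
        = (Ehat i l - E i l) - ∑ k, c k * (Ehat (Fin.castLE hKW k) l
            - E (Fin.castLE hKW k) l) := by
      simp only [hEk, hEG i l, mul_sub, sub_mul, Finset.sum_sub_distrib]
      ring
    rw [e1]
    have h2 : |∑ k, c k * (Ehat (Fin.castLE hKW k) l - E (Fin.castLE hKW k) l)| ≤ ε := by
      calc _ ≤ ∑ k, |c k * (Ehat (Fin.castLE hKW k) l - E (Fin.castLE hKW k) l)| :=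
            Finset.abs_sum_le_sum_abs _ _
        _ ≤ ∑ k, c k * ε := by
            apply Finset.sum_le_sum
            intro k _
            rw [abs_mul, abs_of_nonneg (hc k)]
            exact mul_le_mul_of_nonneg_left (hEhat _ _) (hc k)
        _ = ε := by rw [← Finset.sum_mul, hs, one_mul]
    have h3 := abs_sub (Ehat i l - E i l)
      (∑ k, c k * (Ehat (Fin.castLE hKW k) l - E (Fin.castLE hKW k) l))
    linarith [hEhat i l]
  have hstar : ∑ l, (Ehat i l - ∑ k, B i k * Ehat (Fin.castLE hKW k) l) ^ 2
      ≤ W * (2 * ε) ^ 2 := by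
    calc _ ≤ ∑ _l : Fin W, (2 * ε) ^ 2 := by
          apply Finset.sum_le_sum
          intro l _
          have := hpert (B i) (hBnn i) (hBrow i) l
          simp only [sub_self, zero_mul, Finset.sum_const_zero, sub_zero] at this
          exact sq_le_sq' (by linarith [(abs_le.mp this).1]) (abs_le.mp this).2
      _ = _ := by simp
  have hhat := (Real.sqrt_le_sqrt_iff (Finset.sum_nonneg (fun l _ => sq_nonneg _))).mp
    (hbhat_min (B i) (hBnn i) (hBrow i))
  have hr : ∑ l, (∑ k, (B i k - bhat k) * G k l) ^ 2 ≤ 16 * W * ε ^ 2 := by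
    calc _ ≤ ∑ l : Fin W, (2 * (Ehat i l - ∑ k, bhat k * Ehat (Fin.castLE hKW k) l) ^ 2
            + 2 * (2 * ε) ^ 2) := by
          apply Finset.sum_le_sum
          intro l _
          have := hpert bhat hbhat_nn hbhat_sum l
          have h4 := sq_le_sq' (by linarith [(abs_le.mp this).1]) (abs_le.mp this).2
          generalize (Ehat i l - ∑ k, bhat k * Ehat (Fin.castLE hKW k) l) = a at *
          generalize ∑ k, (B i k - bhat k) * G k l = b at *
          nlinarith [sq_nonneg (2 * a - b)]
      _ = 2 * ∑ l : Fin W, (Ehat i l - ∑ k, bhat k * Ehat (Fin.castLE hKW k) l) ^ 2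
            + W * (2 * (2 * ε) ^ 2) := by
          rw [Finset.sum_add_distrib, ← Finset.mul_sum]; simp
      _ ≤ _ := by nlinarith
  set d : Fin K → ℝ := fun k => bhat k - B i k with hd
  have hRd : ∑ k, (R.mulVec d k) ^ 2 ≤ 16 * W * ε ^ 2 := by
    refine le_trans ?_ hr
    have e : ∀ k, (R.mulVec d k) ^ 2
        = (∑ m, (B i m - bhat m) * G m (Fin.castLE hKW k)) ^ 2 := by
      intro k
      have : ∑ m, (B i m - bhat m) * G m (Fin.castLE hKW k) = - R.mulVec d k := by
        simp only [hGk, Matrix.mulVec, dotProduct, hd]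
        rw [← Finset.sum_neg_distrib]
        refine Finset.sum_congr rfl fun m _ => ?_
        rw [← hRsymm.apply k m]; ring
      rw [this]; ring
    rw [Finset.sum_congr rfl (fun k _ => e k)]
    rw [← Finset.sum_image (s := Finset.univ) (g := Fin.castLE hKW)
      (f := fun l => (∑ m, (B i m - bhat m) * G m l) ^ 2)
      (fun a _ b _ h => Fin.castLE_injective hKW h)]
    exact Finset.sum_le_sum_of_subset_of_nonneg (Finset.subset_univ _)
      (fun _ _ _ => sq_nonneg _)
  have hcs : (d ⬝ᵥ R.mulVec d) ^ 2 ≤ (∑ k, d k ^ 2) * ∑ k, (R.mulVec d k) ^ 2 :=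
    Finset.sum_mul_sq_le_sq_mul_sq _ _ _
  have hm := hmin d
  change Real.sqrt (∑ k, d k ^ 2) ≤ _
  have hS : 0 ≤ ∑ k, d k ^ 2 := Finset.sum_nonneg fun _ _ => sq_nonneg _
  generalize (∑ k, d k ^ 2) = S at *
  have hW : Real.sqrt W ^ 2 = W := Real.sq_sqrt (Nat.cast_nonneg W)
  apply Real.sqrt_le_iff.mpr
  refine ⟨by positivity, ?_⟩
  have e : (4 * Real.sqrt W / lammin * ε) ^ 2 = 16 * W * ε ^ 2 / lammin ^ 2 := by
    rw [mul_pow, div_pow, mul_pow, hW]; ring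
  rw [e, le_div_iff₀ (by positivity)]
  rcases hS.eq_or_lt with h0 | h0
  · rw [← h0, zero_mul]; positivity
  · have h5 : (lammin * S) ^ 2 ≤ S * (16 * W * ε ^ 2) :=
      (pow_le_pow_left₀ (by positivity) hm 2).trans
        (hcs.trans (mul_le_mul_of_nonneg_left hRd hS))
    refine le_of_mul_le_mul_left ?_ h0
    linarith [h5, show S * (S * lammin ^ 2) = (lammin * S) ^ 2 by ring]
end
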